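/- Let λ = (λ_1,…,λ_n) be a vector of positive integers and let Λ = ⟨1/λ_1,…,1/λ_n⟩ be the additive submonoid of ℚ_{≥0} generated by 1/λ_1,…,1/λ_n. If the ideal I(λ) ⊆ K[x_1,…,x_n] is normal, then Λ is quasinormal. -/

import Mathlib

/-- `x` is integral over the ideal `I`: there are `m ≥ 1` and `a j ∈ I ^ j` (`j = 1, …, m`)
with `x ^ m + a 1 * x ^ (m - 1) + ⋯ + a m = 0`. -/
def IdealIntegral {R : Type*} [CommRing R] (I : Ideal R) (x : R) : Prop :=
  ∃ m : ℕ, 0 < m ∧ ∃ a : ℕ → R, (∀ j ∈ Finset.Icc 1 m, a j ∈ I ^ j) ∧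
    x ^ m + ∑ j ∈ Finset.Icc 1 m, a j * x ^ (m - j) = 0

/-- A submonoid `Λ` of `ℚ_{≥0}` is quasinormal if whenever `x ∈ Λ` and `x ≥ p` for a
positive integer `p`, then `x = y_1 + ⋯ + y_p` with all `y_j ∈ Λ` and `y_j ≥ 1`. -/
def Quasinormal (Λ : AddSubmonoid ℚ) : Prop :=
  ∀ x ∈ Λ, ∀ p : ℕ, 0 < p → (p : ℚ) ≤ x →
    ∃ y : Fin p → ℚ, (∀ j, y j ∈ Λ) ∧ (∀ j, 1 ≤ y j) ∧ x = ∑ j, y j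

open MvPolynomial in
/-- The `p`-th power of the ideal generated by the monomials with exponents in `B` lies in the
ideal generated by the monomials whose exponent is a sum of `p` elements of `B`. -/
theorem span_monomial_pow_le {σ K : Type*} [CommSemiring K] (B : Set (σ →₀ ℕ)) (p : ℕ) :
    Ideal.span ((fun s => monomial s (1 : K)) '' B) ^ p ≤
      Ideal.span ((fun s => monomial s (1 : K)) ''
        {a | ∃ b : Fin p → σ →₀ ℕ, (∀ j, b j ∈ B) ∧ a = ∑ j, b j}) := by
  induction p with
  | zero =>
    rw [pow_zero, Ideal.one_eq_top, top_le_iff, Ideal.eq_top_iff_one]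
    exact Ideal.subset_span ⟨0, ⟨Fin.elim0, fun j => j.elim0, by simp⟩, rfl⟩
  | succ p ih =>
    rw [pow_succ]
    refine (Ideal.mul_mono_left ih).trans ?_
    rw [Ideal.span_mul_span', Ideal.span_le]
    rintro _ ⟨_, ⟨a, ⟨b, hb, rfl⟩, rfl⟩, _, ⟨c, hc, rfl⟩, rfl⟩
    refine Ideal.subset_span ⟨∑ j, b j + c, ⟨Fin.snoc b c, ?_, ?_⟩, ?_⟩
    · intro j
      induction j using Fin.lastCases with
      | last => simpa using hc
      | cast j => simpa using hb j
    · simp [Fin.sum_univ_castSucc]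
    · simp [monomial_mul]

theorem IdealIntegral.map {R S : Type*} [CommRing R] [CommRing S] {I : Ideal R} {x : R}
    (φ : R →+* S) (h : IdealIntegral I x) : IdealIntegral (I.map φ) (φ x) := by
  obtain ⟨m, hm, a, ha, h⟩ := h
  refine ⟨m, hm, fun j => φ (a j), fun j hj => ?_, ?_⟩
  · rw [← Ideal.map_pow]
    exact Ideal.mem_map_of_mem φ (ha j hj)
  · simpa using congrArg φ h

theorem IdealIntegral.mono {R : Type*} [CommRing R] {I J : Ideal R} {x : R}
    (hIJ : I ≤ J) (h : IdealIntegral I x) : IdealIntegral J x := by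
  obtain ⟨m, hm, a, ha, h⟩ := h
  exact ⟨m, hm, a, fun j hj => Ideal.pow_right_mono hIJ j (ha j hj), h⟩

theorem IdealIntegral.of_pow_mem {R : Type*} [CommRing R] {I : Ideal R} {x : R} {m : ℕ}
    (hm : 0 < m) (h : x ^ m ∈ I ^ m) : IdealIntegral I x := by
  refine ⟨m, hm, Pi.single m (-x ^ m), fun j _ => ?_, ?_⟩
  · obtain rfl | hj := eq_or_ne j m
    · simpa using h
    · simp [Pi.single_eq_of_ne hj]
  · rw [Finset.sum_eq_single_of_mem m (by simp; lia)]
    · simp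
    · intro j _ hj
      simp [Pi.single_eq_of_ne hj]

/-- Principal ideals generated by a power of a prime element are integrally closed. -/
theorem IdealIntegral.pow_dvd {R : Type*} [CommRing R] [IsDomain R] [WfDvdMonoid R] {t x : R}
    (ht : Prime t) {L : ℕ} (h : IdealIntegral (Ideal.span {t ^ L}) x) : t ^ L ∣ x := by
  obtain rfl | hx := eq_or_ne x 0
  · exact dvd_zero _
  obtain ⟨e, g, hg, rfl⟩ := WfDvdMonoid.max_power_factor hx ht.irreducible
  by_contra hL
  have heL : e < L := by
    by_contra! hle
    exact hL ((pow_dvd_pow t hle).mul_right g)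
  obtain ⟨m, -, a, ha, h⟩ := h
  have hdvd : t ^ (e * m + 1) ∣ ∑ j ∈ Finset.Icc 1 m, a j * (t ^ e * g) ^ (m - j) := by
    refine Finset.dvd_sum fun j hj => ?_
    have haj := ha j hj
    rw [Ideal.span_singleton_pow, Ideal.mem_span_singleton, ← pow_mul] at haj
    obtain ⟨i, rfl⟩ := Nat.exists_eq_add_of_le (Finset.mem_Icc.mp hj).2
    have hj1 := (Finset.mem_Icc.mp hj).1
    have hexp : e * (j + i) + 1 ≤ L * j + e * i := by nlinarith
    refine (pow_dvd_pow t hexp).trans ?_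
    rw [pow_add, Nat.add_sub_cancel_left, mul_pow, ← pow_mul]
    exact mul_dvd_mul haj (Dvd.intro _ rfl)
  rw [(neg_eq_of_add_eq_zero_right h).symm, dvd_neg, mul_pow, ← pow_mul, pow_succ,
    mul_dvd_mul_iff_left (pow_ne_zero _ ht.ne_zero)] at hdvd
  exact hg (ht.dvd_of_dvd_pow hdvd)

open MvPolynomial in
/-- The ring homomorphism multiplying each monomial of weight `k` by the `k`-th power of a new
variable. -/
noncomputable def weightGrading {σ : Type*} (K : Type*) [CommSemiring K] (w : σ → ℕ) :
    MvPolynomial σ K →ₐ[K] Polynomial (MvPolynomial σ K) :=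
  aeval fun i => Polynomial.C (X i) * Polynomial.X ^ w i

open MvPolynomial in
theorem weightGrading_monomial {σ K : Type*} [CommSemiring K] (w : σ → ℕ) (a : σ →₀ ℕ) (c : K) :
    weightGrading K w (monomial a c) =
      Polynomial.monomial (Finsupp.weight w a) (monomial a c) := by
  rw [weightGrading, aeval_monomial, ← Polynomial.C_mul_X_pow_eq_monomial, Finsupp.weight_apply,
    monomial_eq, Finsupp.prod, Finsupp.prod, Finsupp.sum]
  simp_rw [mul_pow, Finset.prod_mul_distrib, ← pow_mul, Finset.prod_pow_eq_pow_sum, map_mul,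
    map_prod, map_pow, smul_eq_mul, mul_comm (w _), mul_assoc]
  rfl

open MvPolynomial in
theorem coeff_coeff_weightGrading {σ K : Type*} [CommSemiring K] (w : σ → ℕ) (a : σ →₀ ℕ)
    (f : MvPolynomial σ K) :
    coeff a ((weightGrading K w f).coeff (Finsupp.weight w a)) = coeff a f := by
  classical
  induction f using MvPolynomial.induction_on' with
  | monomial b c =>
    rw [weightGrading_monomial, Polynomial.coeff_monomial]
    split_ifs with h
    · rfl
    · rw [coeff_zero, coeff_monomial, if_neg]
      rintro rfl
      exact h rfl
  | add p q hp hq => simp [hp, hq]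

open MvPolynomial in
/-- Elements integral over an ideal generated by powers of variables of weight `L` only involve
monomials of weight at least `L`. -/
theorem le_weight_of_idealIntegral {σ K : Type*} [Field K] {w lam : σ → ℕ} {L : ℕ}
    (hw : ∀ i, lam i * w i = L) {f : MvPolynomial σ K}
    (hf : IdealIntegral (Ideal.span (Set.range fun i => (X i : MvPolynomial σ K) ^ lam i)) f)
    {a : σ →₀ ℕ} (ha : a ∈ f.support) : L ≤ Finsupp.weight w a := by
  have hmap : IdealIntegral (Ideal.span {(Polynomial.X : Polynomial (MvPolynomial σ K)) ^ L})
      (weightGrading K w f) := by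
    refine (hf.map (weightGrading K w).toRingHom).mono ?_
    rw [Ideal.map_span, Ideal.span_le]
    rintro _ ⟨_, ⟨i, rfl⟩, rfl⟩
    rw [SetLike.mem_coe, Ideal.mem_span_singleton]
    simp [weightGrading, mul_pow, ← pow_mul, mul_comm (w i), hw]
  have hdvd := Polynomial.X_pow_dvd_iff.mp (hmap.pow_dvd Polynomial.prime_X)
  by_contra! hlt
  have h := coeff_coeff_weightGrading w a f
  rw [hdvd _ hlt, coeff_zero] at h
  exact mem_support_iff.mp ha h.symm

/-- If `I(λ) = \overline{(x_1^{λ_1}, …, x_n^{λ_n})}` is normal, then the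
additive submonoid `Λ = ⟨1/λ_1, …, 1/λ_n⟩` of `ℚ_{≥0}` is quasinormal. -/
theorem quasinormal_of_I_lambda_normal
    {K : Type*} [Field K] {n : ℕ}
    (lam : Fin n → ℕ) (hlam : ∀ i, 0 < lam i)
    (J Ilam : Ideal (MvPolynomial (Fin n) K))
    (hJ : J = Ideal.span (Set.range fun i => (MvPolynomial.X i : MvPolynomial (Fin n) K) ^ lam i))
    -- `I(λ)` is the integral closure of `J(λ)`
    (hIlam : ∀ x : MvPolynomial (Fin n) K, x ∈ Ilam ↔ IdealIntegral J x)
    -- `I(λ)` is normal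
    (hnormal : ∀ k : ℕ, 0 < k → ∀ x : MvPolynomial (Fin n) K,
      IdealIntegral (Ilam ^ k) x → x ∈ Ilam ^ k)
    (Λ : AddSubmonoid ℚ)
    (hΛ : Λ = AddSubmonoid.closure (Set.range fun i => ((lam i : ℚ))⁻¹)) :
    Quasinormal Λ := by
  classical
  subst hJ hΛ
  intro x hx p hp hpx
  set L := ∏ i, lam i
  have hL : 0 < L := Finset.prod_pos fun i _ => hlam i
  have hLQ : (0 : ℚ) < L := by exact_mod_cast hL
  set w : Fin n → ℕ := fun i => ∏ j ∈ Finset.univ.erase i, lam j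
  have hw : ∀ i, lam i * w i = L := fun i => Finset.mul_prod_erase _ _ (Finset.mem_univ i)
  set W := Finsupp.weight (R := ℕ) fun i => ((lam i : ℚ))⁻¹ with hW
  have hWw : ∀ a : Fin n →₀ ℕ, (Finsupp.weight w a : ℚ) = L * W a := by
    intro a
    simp only [hW, Finsupp.weight_eq_sum, Nat.cast_sum, Finset.mul_sum, smul_eq_mul, nsmul_eq_mul]
    refine Finset.sum_congr rfl fun i _ => ?_
    have hi : (lam i : ℚ) ≠ 0 := by exact_mod_cast (hlam i).ne'
    rw [← hw i]
    push_cast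
    field_simp
  have hWmem : ∀ a, W a ∈ AddSubmonoid.closure (Set.range fun i => ((lam i : ℚ))⁻¹) := by
    intro a
    rw [hW, Finsupp.weight_eq_sum]
    exact sum_mem fun i _ => nsmul_mem (AddSubmonoid.subset_closure (Set.mem_range_self i)) _
  obtain ⟨a, rfl⟩ : ∃ a, W a = x := by
    have hle : AddSubmonoid.closure (Set.range fun i => ((lam i : ℚ))⁻¹) ≤
        AddMonoidHom.mrange W := by
      rw [AddSubmonoid.closure_le]
      rintro _ ⟨i, rfl⟩
      exact ⟨Finsupp.single i 1, by simp [hW, Finsupp.weight_single]⟩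
    exact hle hx
  have hJI : Ideal.span (Set.range fun i => (MvPolynomial.X i : MvPolynomial (Fin n) K) ^ lam i)
      ≤ Ilam := fun f hf => (hIlam f).mpr (.of_pow_mem one_pos (by simpa using hf))
  have hpow : MvPolynomial.monomial a (1 : K) ^ L ∈ (Ilam ^ p) ^ L := by
    have hle : p * L ≤ ∑ i, w i * a i := by
      have : ((p * L : ℕ) : ℚ) ≤ (Finsupp.weight w a : ℕ) := by
        rw [hWw]
        push_cast
        nlinarith
      have h := Nat.cast_le.mp this
      simpa [Finsupp.weight_eq_sum, mul_comm] using h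
    rw [← pow_mul]
    refine Ideal.pow_le_pow_right hle ?_
    rw [← Finset.prod_pow_eq_pow_sum, MvPolynomial.monomial_eq, Finsupp.prod_fintype _ _ (by simp),
      map_one, one_mul, ← Finset.prod_pow]
    refine Ideal.prod_mem_prod fun i _ => ?_
    rw [← hw i, ← pow_mul, show a i * (lam i * w i) = lam i * (w i * a i) by ring,
      pow_mul (MvPolynomial.X i)]
    exact Ideal.pow_mem_pow (hJI (Ideal.subset_span ⟨i, rfl⟩)) (w i * a i)
  have hmem := hnormal p hp _ (.of_pow_mem hL hpow)
  have hIB : Ilam ≤ Ideal.span ((fun s => MvPolynomial.monomial s (1 : K)) ''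
      {b | L ≤ Finsupp.weight w b}) := fun f hf =>
    MvPolynomial.mem_ideal_span_monomial_image.mpr fun b hb =>
      ⟨b, le_weight_of_idealIntegral hw ((hIlam f).mp hf) hb, le_rfl⟩
  obtain ⟨s, ⟨b, hb, rfl⟩, hs⟩ := MvPolynomial.mem_ideal_span_monomial_image.mp
    (span_monomial_pow_le _ p (Ideal.pow_right_mono hIB p hmem)) a (by simp)
  obtain ⟨c, rfl⟩ := exists_add_of_le hs
  have hW1 : ∀ j, 1 ≤ W (b j) := by
    intro j
    have h : (L : ℚ) ≤ L * W (b j) := by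
      rw [← hWw]
      exact_mod_cast hb j
    nlinarith
  have hW0 : 0 ≤ W c := by
    have h : 0 ≤ L * W c := by
      rw [← hWw]
      positivity
    nlinarith
  refine ⟨fun j => W (b j + if j = ⟨0, hp⟩ then c else 0), fun j => hWmem _, fun j => ?_, ?_⟩
  · dsimp only
    rw [map_add]
    split_ifs
    · linarith [hW1 j]
    · simpa using hW1 j
  · simp [← map_sum, Finset.sum_add_distrib]
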